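/- arXiv:1112.0217 — 3 statements merged into one kernel-verified Lean document; each statement's English description precedes it below -/
import Mathlib

section
/- Let M ∈ ℝ^{n×n} be a P-matrix and q ∈ ℝⁿ. If w̃, z̃ ∈ ℝⁿ solve LCP(M,q) and B̃ := {i ∈ [n] : w̃_i = 0}, then w̃ = w(B̃) and z̃ = z(B̃); in particular B̃ is an optimal basis for LCP(M,q). -/
open Matrix

/-- The basis matrix `M̄_B`: column `j` is the `j`-th column of `-M` if `j ∈ B`,
and the `j`-th column of the identity matrix otherwise. -/
def basisMatrix {ι : Type*} [Fintype ι] [DecidableEq ι]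
    (M : Matrix ι ι ℝ) (B : Finset ι) : Matrix ι ι ℝ :=
  fun i j => if j ∈ B then -M i j else if i = j then 1 else 0

/-- A P-matrix: every principal minor is positive. -/
def IsPMatrix {ι : Type*} [Fintype ι] [DecidableEq ι] (M : Matrix ι ι ℝ) : Prop :=
  ∀ K : Finset ι, 0 < (M.submatrix (fun i : K => i.1) (fun j : K => j.1)).det

/-- The vector `w(B)` of the complementary pair. -/
noncomputable def wvec {ι : Type*} [Fintype ι] [DecidableEq ι]
    (M : Matrix ι ι ℝ) (q : ι → ℝ) (B : Finset ι) : ι → ℝ :=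
  fun i => if i ∈ B then 0 else ((basisMatrix M B)⁻¹ *ᵥ q) i

/-- The vector `z(B)` of the complementary pair. -/
noncomputable def zvec {ι : Type*} [Fintype ι] [DecidableEq ι]
    (M : Matrix ι ι ℝ) (q : ι → ℝ) (B : Finset ι) : ι → ℝ :=
  fun i => if i ∈ B then ((basisMatrix M B)⁻¹ *ᵥ q) i else 0

/-- `(w, z)` solves the linear complementarity problem LCP(M,q). -/
def SolvesLCP {ι : Type*} [Fintype ι] (M : Matrix ι ι ℝ) (q w z : ι → ℝ) : Prop :=
  w - M *ᵥ z = q ∧ (∀ i, 0 ≤ w i) ∧ (∀ i, 0 ≤ z i) ∧ w ⬝ᵥ z = 0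

/-- `B` is an optimal basis for LCP(M,q). -/
noncomputable def OptimalBasis {ι : Type*} [Fintype ι] [DecidableEq ι]
    (M : Matrix ι ι ℝ) (q : ι → ℝ) (B : Finset ι) : Prop :=
  SolvesLCP M q (wvec M q B) (zvec M q B)

/-- LCP(M,q) is nondegenerate. -/
def Nondeg {ι : Type*} [Fintype ι] [DecidableEq ι] (M : Matrix ι ι ℝ) (q : ι → ℝ) : Prop :=
  ∀ B : Finset ι, ∀ i, ((basisMatrix M B)⁻¹ *ᵥ q) i ≠ 0

/-- `M` is lower Hessenberg: `m_{ij} = 0` whenever `j - i > 1`. -/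
def LowerHessenberg {k : ℕ} (M : Matrix (Fin k) (Fin k) ℝ) : Prop :=
  ∀ i j : Fin k, (i : ℕ) + 1 < (j : ℕ) → M i j = 0

/-- `M` is upper Hessenberg: `m_{ij} = 0` whenever `i - j > 1`. -/
def UpperHessenberg {k : ℕ} (M : Matrix (Fin k) (Fin k) ℝ) : Prop :=
  ∀ i j : Fin k, (j : ℕ) + 1 < (i : ℕ) → M i j = 0

theorem basisMatrix_det {ι : Type*} [Fintype ι] [DecidableEq ι]
    (M : Matrix ι ι ℝ) (B : Finset ι) :
    (basisMatrix M B).det =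
      (-1) ^ B.card * (M.submatrix (fun i : B => i.1) (fun j : B => j.1)).det := by
  have hB : (basisMatrix M B).toSquareBlockProp (fun i => i ∈ B) =
      -M.submatrix (fun i : B => i.1) (fun j : B => j.1) := by
    ext i j
    have := j.2
    simp_all [basisMatrix, toSquareBlockProp]
  have hBc : (basisMatrix M B).toSquareBlockProp (fun i => i ∉ B) = 1 := by
    ext i j
    have := j.2
    simp_all [basisMatrix, toSquareBlockProp, Matrix.one_apply, Subtype.ext_iff]
  have hzero : ∀ i, i ∈ B → ∀ j, j ∉ B → basisMatrix M B i j = 0 := by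
    intro i hi j hj
    have hij : i ≠ j := fun h => hj (h ▸ hi)
    simp [basisMatrix, hj, hij]
  have hdet : (basisMatrix M B).det =
      (-M.submatrix (fun i : B => i.1) (fun j : B => j.1)).det := by
    rw [twoBlockTriangular_det' _ (fun i => i ∈ B) hzero, hBc, det_one, mul_one, hB]
    congr!
  rw [hdet, det_neg, Fintype.card_coe]

theorem IsPMatrix.isUnit_det_basisMatrix {ι : Type*} [Fintype ι] [DecidableEq ι]
    {M : Matrix ι ι ℝ} (hM : IsPMatrix M) (B : Finset ι) : IsUnit (basisMatrix M B).det := by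
  rw [isUnit_iff_ne_zero, basisMatrix_det]
  exact mul_ne_zero (pow_ne_zero _ (by norm_num)) (hM B).ne'

theorem SolvesLCP.mul_eq_zero {ι : Type*} [Fintype ι] {M : Matrix ι ι ℝ} {q w z : ι → ℝ}
    (h : SolvesLCP M q w z) (i : ι) : w i * z i = 0 := by
  obtain ⟨-, hw, hz, hwz⟩ := h
  exact (Finset.sum_eq_zero_iff_of_nonneg fun j _ => mul_nonneg (hw j) (hz j)).1 hwz i
    (Finset.mem_univ i)

theorem basisMatrix_mulVec_ite {ι : Type*} [Fintype ι] [DecidableEq ι]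
    (M : Matrix ι ι ℝ) (B : Finset ι) {w z : ι → ℝ}
    (hw : ∀ i ∈ B, w i = 0) (hz : ∀ i ∉ B, z i = 0) :
    basisMatrix M B *ᵥ (fun i => if i ∈ B then z i else w i) = w - M *ᵥ z := by
  have hcol : basisMatrix M B *ᵥ (fun i => if i ∈ B then z i else w i) =
      (1 : Matrix ι ι ℝ) *ᵥ w - M *ᵥ z := by
    ext i
    simp only [mulVec, dotProduct, Pi.sub_apply, ← Finset.sum_sub_distrib]
    refine Finset.sum_congr rfl fun j _ => ?_
    by_cases hj : j ∈ B
    · simp [basisMatrix, hj, hw j hj]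
    · simp [basisMatrix, hj, hz j hj, Matrix.one_apply]
  rw [hcol, one_mulVec]

theorem eq_wvec_and_eq_zvec {ι : Type*} [Fintype ι] [DecidableEq ι]
    {M : Matrix ι ι ℝ} {q : ι → ℝ} {B : Finset ι} {w z : ι → ℝ}
    (hB : IsUnit (basisMatrix M B).det) (hq : w - M *ᵥ z = q)
    (hw : ∀ i ∈ B, w i = 0) (hz : ∀ i ∉ B, z i = 0) :
    w = wvec M q B ∧ z = zvec M q B := by
  have hinv : (basisMatrix M B)⁻¹ *ᵥ q = fun i => if i ∈ B then z i else w i := by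
    rw [← hq, ← basisMatrix_mulVec_ite M B hw hz, mulVec_mulVec, nonsing_inv_mul _ hB,
      one_mulVec]
  constructor <;> ext i <;> by_cases hi : i ∈ B <;> simp [wvec, zvec, hinv, hi, hw, hz]

open scoped Classical in
/-- if `(wt, zt)` solves LCP(M,q) and `Bt = {i : wt i = 0}`, then
`wt = w(Bt)`, `zt = z(Bt)`, and `Bt` is an optimal basis. -/
theorem stmt_4 (n : ℕ) (M : Matrix (Fin n) (Fin n) ℝ) (hM : IsPMatrix M)
    (q : Fin n → ℝ) (wt zt : Fin n → ℝ) (hsol : SolvesLCP M q wt zt) :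
    wt = wvec M q (Finset.univ.filter (fun i => wt i = 0)) ∧
    zt = zvec M q (Finset.univ.filter (fun i => wt i = 0)) ∧
    OptimalBasis M q (Finset.univ.filter (fun i => wt i = 0)) := by
  obtain ⟨hw, hz⟩ := eq_wvec_and_eq_zvec
    (hM.isUnit_det_basisMatrix (Finset.univ.filter (fun i => wt i = 0))) hsol.1
    (fun i hi => (Finset.mem_filter.1 hi).2)
    (fun i hi => (mul_eq_zero.1 (hsol.mul_eq_zero i)).resolve_left
      fun h => hi (Finset.mem_filter.2 ⟨Finset.mem_univ i, h⟩))
  refine ⟨hw, hz, ?_⟩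
  rwa [OptimalBasis, ← hw, ← hz]
end

section
/- Let M ∈ ℝ^{n×n} be a P-matrix and q ∈ ℝⁿ such that LCP(M,q) is nondegenerate. Then for every K ⊆ [n], the subproblem LCP(M_{KK}, q_K) is nondegenerate as well. -/
open Matrix

/-- If the rows of `A` indexed by `K` vanish outside the columns in `K`, then restricting to `K`
commutes with applying `A`. -/
theorem submatrix_mulVec_restrict {ι R : Type*} [Fintype ι] [NonUnitalNonAssocSemiring R]
    (A : Matrix ι ι R) (K : Finset ι) (hA : ∀ i ∈ K, ∀ j ∉ K, A i j = 0) (x : ι → R) :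
    (A.submatrix (fun i : K => i.1) (fun j : K => j.1)) *ᵥ (fun j : K => x j.1) =
      fun i : K => (A *ᵥ x) i.1 := by
  funext i
  simp only [mulVec, dotProduct, submatrix_apply]
  rw [Finset.sum_coe_sort K (fun j => A i.1 j * x j)]
  exact Finset.sum_subset (Finset.subset_univ K) fun j _ hj => by
    rw [hA i.1 i.2 j hj, zero_mul]

/-- If the rows of `A` indexed by `K` vanish outside the columns in `K`, and `A` is invertible, then
solving the linear system with right-hand side `q` commutes with restricting to `K`. -/
theorem inv_submatrix_mulVec_restrict {ι R : Type*} [Fintype ι] [DecidableEq ι] [CommRing R]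
    (A : Matrix ι ι R) (K : Finset ι) (hA : ∀ i ∈ K, ∀ j ∉ K, A i j = 0) (hdet : IsUnit A.det)
    (q : ι → R) :
    (A.submatrix (fun i : K => i.1) (fun j : K => j.1))⁻¹ *ᵥ (fun j : K => q j.1) =
      fun i : K => (A⁻¹ *ᵥ q) i.1 := by
  have hmul : A.submatrix (fun i : K => i.1) (fun j : K => j.1) *
      A⁻¹.submatrix (fun i : K => i.1) (fun j : K => j.1) = 1 := by
    ext i l
    have h := congrFun (submatrix_mulVec_restrict A K hA fun j => A⁻¹ j l.1) i
    have h' := congrFun (congrFun (mul_nonsing_inv A hdet) i.1) l.1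
    refine (h.trans h').trans ?_
    simp only [one_apply, SetLike.coe_eq_coe]
  have hq := submatrix_mulVec_restrict A K hA (A⁻¹ *ᵥ q)
  rw [mulVec_mulVec, mul_nonsing_inv A hdet, one_mulVec] at hq
  rw [← hq, mulVec_mulVec, nonsing_inv_mul _ (isUnit_det_of_right_inverse hmul), one_mulVec]

/-- The basis matrix of a principal submatrix is a principal submatrix of a basis matrix. -/
theorem basisMatrix_submatrix {ι : Type*} [Fintype ι] [DecidableEq ι]
    (M : Matrix ι ι ℝ) (K : Finset ι) (B : Finset K) :
    basisMatrix (M.submatrix (fun i : K => i.1) (fun j : K => j.1)) B =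
      (basisMatrix M (B.map (Function.Embedding.subtype _))).submatrix
        (fun i : K => i.1) (fun j : K => j.1) := by
  ext i j
  simp [basisMatrix]

/-- nondegeneracy is inherited by all principal subproblems. -/
theorem stmt_7 (n : ℕ) (M : Matrix (Fin n) (Fin n) ℝ) (hM : IsPMatrix M)
    (q : Fin n → ℝ) (hnd : Nondeg M q) (K : Finset (Fin n)) :
    Nondeg (M.submatrix (fun i : K => i.1) (fun j : K => j.1))
      (fun j : K => q j.1) := by
  intro B i
  set A := basisMatrix M (B.map (Function.Embedding.subtype _)) with hAdef
  have hne : (A⁻¹ *ᵥ q) i.1 ≠ 0 := hnd _ i.1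
  have hdet : IsUnit A.det := by
    by_contra h
    simp [nonsing_inv_apply_not_isUnit A h] at hne
  have hA : ∀ i ∈ K, ∀ j ∉ K, A i j = 0 := by
    intro i hi j hj
    have hij : i ≠ j := fun h => hj (h ▸ hi)
    simp [hAdef, basisMatrix, hj, hij]
  rw [basisMatrix_submatrix, ← hAdef, inv_submatrix_mulVec_restrict A K hA hdet]
  exact hne
end

section
/- Let M ∈ ℝ^{n×n} be a lower Hessenberg P-matrix and q ∈ ℝⁿ such that LCP(M,q) is nondegenerate. Then for every k ∈ [n], B(k) is the unique set B in the (k+1)-element candidate family { B(ℓ) ∪ {ℓ+2, ℓ+3, …, k} : ℓ ∈ {−1, 0, …, k−1} } satisfying (M_{[k][k]})̄_B⁻¹ q_{[k]} ≥ 0; in particular, the optimal basis B(n) of LCP(M,q) can be determined by testing at most ∑_{k=1}^n k = C(n+1,2) candidate bases. -/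
open Matrix

/-- The candidate basis `B(l-1) ∪ {l+1, …, k}` (paper's `B(ℓ) ∪ {ℓ+2, …, k}`
with `l = ℓ + 1`, all in 1-based notation; here encoded 0-based in `Fin k`). -/
def candidate {n : ℕ} (Bf : ∀ j : ℕ, j ≤ n → Finset (Fin j))
    (k : ℕ) (hkn : k ≤ n) (l : ℕ) (hl : l ≤ k) : Finset (Fin k) :=
  (Bf (l - 1) (by omega)).image (Fin.castLE (by omega)) ∪
    Finset.univ.filter (fun i : Fin k => l ≤ (i : ℕ))

section PMatrix

variable {ι κ : Type*} [Fintype ι] [Fintype κ]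

/-- `M` reverses the sign of no nonzero vector. -/
def ReversesNoSign (M : Matrix ι ι ℝ) : Prop :=
  ∀ d : ι → ℝ, (∀ i, d i * (M *ᵥ d) i ≤ 0) → d = 0

lemma ReversesNoSign.submatrix {M : Matrix κ κ ℝ} (hM : ReversesNoSign M) {f : ι → κ}
    (hf : Function.Injective f) : ReversesNoSign (M.submatrix f f) := by
  intro d hd
  set e : κ → ℝ := Function.extend f d 0 with he
  have hef (i : ι) : e (f i) = d i := hf.extend_apply d 0 i
  have he0 (j : κ) (hj : j ∉ Set.range f) : e j = 0 := Function.extend_apply' d (0 : κ → ℝ) j hj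
  have hMe (i : ι) : (M.submatrix f f *ᵥ d) i = (M *ᵥ e) (f i) :=
    Fintype.sum_of_injective f hf _ _ (fun j hj => by simp [he0 j hj]) (fun j => by simp [hef])
  have h0 : e = 0 := by
    refine hM e fun j => ?_
    by_cases hj : j ∈ Set.range f
    · obtain ⟨i, rfl⟩ := hj
      rw [hef, ← hMe]
      exact hd i
    · simp [he0 j hj]
  ext i
  rw [← hef, h0]
  rfl

variable [DecidableEq ι] [DecidableEq κ]

lemma det_ite_diagonal (M : Matrix ι ι ℝ) (b : ι → ℝ) (S : Finset ι) :
    (Matrix.of fun i j => if i ∈ S then M i j else diagonal b i j).det =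
      (M.submatrix (fun i : S => i.1) (fun j : S => j.1)).det * ∏ i ∈ Sᶜ, b i := by
  set N : Matrix ι ι ℝ := Matrix.of fun i j => if i ∈ S then M i j else diagonal b i j with hN
  have h1 : toSquareBlockProp N (fun i => i ∈ S) =
      M.submatrix (fun i : S => i.1) (fun j : S => j.1) := by
    ext i j
    have hi : i.1 ∈ S := i.2
    rw [toSquareBlockProp_def]
    simp [hN]
  have h2 : toSquareBlockProp N (fun i => ¬ i ∈ S) =
      diagonal (fun i : {i // ¬ i ∈ S} => b i) := by
    ext i j
    have hi : i.1 ∉ S := i.2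
    rw [toSquareBlockProp_def]
    simp [hN, hi, diagonal_apply, Subtype.ext_iff]
  rw [twoBlockTriangular_det N (fun i => i ∈ S), h1, h2, det_diagonal]
  · rw [Finset.prod_subtype (p := fun i => ¬ i ∈ S) Sᶜ (by simp)]
    congr!
  · intro i hi j hj
    have : i ≠ j := by rintro rfl; exact hi hj
    simp [hN, hi, this]

lemma det_diagonal_mul_add_diagonal (M : Matrix ι ι ℝ) (a b : ι → ℝ) :
    (diagonal a * M + diagonal b).det = ∑ S : Finset ι, (∏ i ∈ S, a i) *
      ((M.submatrix (fun i : S => i.1) (fun j : S => j.1)).det * ∏ i ∈ Sᶜ, b i) := by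
  have h := (detRowAlternating (n := ι) (R := ℝ)).toMultilinearMap.map_add_univ
    (fun i => a i • M.row i) (fun i => (diagonal b).row i)
  have hl : diagonal a * M + diagonal b =
      Matrix.of ((fun i => a i • M.row i) + fun i => (diagonal b).row i) := by
    ext i j
    simp [diagonal_apply, Pi.single_apply, eq_comm]
  rw [hl]
  refine h.trans (Finset.sum_congr rfl fun S _ => ?_)
  rw [← det_ite_diagonal M b S]
  set N : Matrix ι ι ℝ := Matrix.of fun i j => if i ∈ S then M i j else diagonal b i j with hN
  have hS : S.piecewise (fun i => a i • M.row i) (fun i => (diagonal b).row i) =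
      S.piecewise (fun i => a i • N.row i) (fun i => N.row i) := by
    ext i j
    by_cases hi : i ∈ S <;> simp [hi, hN, diagonal_apply, Pi.single_apply, eq_comm]
  rw [hS]
  exact (detRowAlternating (n := ι) (R := ℝ)).toMultilinearMap.map_piecewise_smul a
    (fun i => N.row i) S

lemma IsPMatrix.det_diagonal_mul_add_diagonal_pos {M : Matrix ι ι ℝ} (hM : IsPMatrix M)
    {a b : ι → ℝ} (ha : ∀ i, 0 ≤ a i) (hb : ∀ i, 0 ≤ b i) (hab : ∀ i, a i = 0 → 0 < b i) :
    0 < (diagonal a * M + diagonal b).det := by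
  rw [det_diagonal_mul_add_diagonal]
  refine Finset.sum_pos' (fun S _ => ?_) ⟨Finset.univ.filter (fun i => a i ≠ 0), by simp, ?_⟩
  · exact mul_nonneg (Finset.prod_nonneg fun i _ => ha i)
      (mul_nonneg (hM S).le (Finset.prod_nonneg fun i _ => hb i))
  · refine mul_pos (Finset.prod_pos fun i hi => ?_)
      (mul_pos (hM _) (Finset.prod_pos fun i hi => ?_))
    · exact lt_of_le_of_ne (ha i) (by simpa using Ne.symm (by simpa using hi))
    · exact hab i (by simpa using hi)

lemma IsPMatrix.reversesNoSign {M : Matrix ι ι ℝ} (hM : IsPMatrix M) : ReversesNoSign M := by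
  intro d hd
  set a : ι → ℝ := fun i => if d i = 0 then 0 else 1 with ha
  set b : ι → ℝ := fun i => if d i = 0 then 1 else -(M *ᵥ d) i / d i with hb
  have hdet : 0 < (diagonal a * M + diagonal b).det := by
    refine hM.det_diagonal_mul_add_diagonal_pos (fun i => ?_) (fun i => ?_) (fun i hi => ?_)
    · simp only [ha]; split_ifs <;> norm_num
    · simp only [hb]
      split_ifs with h
      · norm_num
      · have : -(M *ᵥ d) i / d i = -(d i * (M *ᵥ d) i) / (d i) ^ 2 := by field_simp
        rw [this]
        exact div_nonneg (by linarith [hd i]) (sq_nonneg _)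
    · have : d i = 0 := by by_contra h; simp [ha, h] at hi
      simp [hb, this]
  refine eq_zero_of_mulVec_eq_zero hdet.ne' ?_
  ext i
  rw [add_mulVec, ← mulVec_mulVec]
  simp only [Pi.add_apply, mulVec_diagonal, Pi.zero_apply, ha, hb]
  by_cases h : d i = 0
  · simp [h]
  · simp [h]

lemma basisMatrix_mulVec (M : Matrix ι ι ℝ) (B : Finset ι) (x : ι → ℝ) :
    basisMatrix M B *ᵥ x =
      (fun i : ι => if i ∈ B then 0 else x i) - M *ᵥ (fun i => if i ∈ B then x i else 0) := by
  ext i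
  have h : (if i ∈ B then 0 else x i) = ∑ j, if i = j then (if j ∈ B then 0 else x j) else 0 := by
    simp
  simp only [Pi.sub_apply, mulVec, dotProduct, h, ← Finset.sum_sub_distrib]
  refine Finset.sum_congr rfl fun j _ => ?_
  by_cases hj : j ∈ B <;> by_cases hij : i = j <;> simp [basisMatrix, hj, hij]

lemma ReversesNoSign.det_basisMatrix_ne_zero {M : Matrix ι ι ℝ} (hM : ReversesNoSign M)
    (B : Finset ι) : (basisMatrix M B).det ≠ 0 := by
  intro h0
  obtain ⟨x, hx, hx0⟩ := exists_mulVec_eq_zero_iff.2 h0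
  rw [basisMatrix_mulVec, sub_eq_zero] at hx0
  have hz : (fun i : ι => if i ∈ B then x i else 0) = (0 : ι → ℝ) := by
    refine hM _ fun i => ?_
    rw [← hx0]
    by_cases hi : i ∈ B <;> simp [hi]
  rw [hz, mulVec_zero] at hx0
  refine hx (funext fun i => ?_)
  by_cases hi : i ∈ B
  · simpa [hi] using congrFun hz i
  · simpa [hi] using congrFun hx0 i

lemma ReversesNoSign.basisMatrix_inv_mulVec_eq {M : Matrix ι ι ℝ} (hM : ReversesNoSign M)
    {B : Finset ι} {q x : ι → ℝ} (hx : basisMatrix M B *ᵥ x = q) :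
    (basisMatrix M B)⁻¹ *ᵥ q = x := by
  rw [← hx, mulVec_mulVec, nonsing_inv_mul _ (hM.det_basisMatrix_ne_zero B).isUnit, one_mulVec]

lemma ReversesNoSign.basisMatrix_mulVec_inv {M : Matrix ι ι ℝ} (hM : ReversesNoSign M)
    (B : Finset ι) (q : ι → ℝ) :
    basisMatrix M B *ᵥ ((basisMatrix M B)⁻¹ *ᵥ q) = q := by
  rw [mulVec_mulVec, mul_nonsing_inv _ (hM.det_basisMatrix_ne_zero B).isUnit, one_mulVec]

/-- In a nondegenerate problem, at most one basis has a nonnegative basic solution. -/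
lemma ReversesNoSign.basis_unique {M : Matrix ι ι ℝ} (hM : ReversesNoSign M) {q : ι → ℝ}
    (hnd : Nondeg M q) {B C : Finset ι} (hB : ∀ i, 0 ≤ ((basisMatrix M B)⁻¹ *ᵥ q) i)
    (hC : ∀ i, 0 ≤ ((basisMatrix M C)⁻¹ *ᵥ q) i) : B = C := by
  have hxq := hM.basisMatrix_mulVec_inv B q
  have hyq := hM.basisMatrix_mulVec_inv C q
  have hx0 := hnd B
  have hy0 := hnd C
  set x := (basisMatrix M B)⁻¹ *ᵥ q
  set y := (basisMatrix M C)⁻¹ *ᵥ q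
  rw [basisMatrix_mulVec] at hxq hyq
  have hd : (fun i : ι => if i ∈ B then x i else 0) - (fun i => if i ∈ C then y i else 0) = 0 := by
    refine hM _ fun i => ?_
    rw [mulVec_sub]
    have h := congrFun (hxq.trans hyq.symm) i
    simp only [Pi.sub_apply] at h ⊢
    have h2 := hB i
    have h3 := hC i
    have h4 : (M *ᵥ fun i => if i ∈ B then x i else 0) i -
        (M *ᵥ fun i => if i ∈ C then y i else 0) i =
        (if i ∈ B then 0 else x i) - (if i ∈ C then 0 else y i) := by linarith
    rw [h4]
    by_cases hiB : i ∈ B <;> by_cases hiC : i ∈ C <;> simp [hiB, hiC] <;> positivity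
  ext i
  have h := congrFun hd i
  by_cases hiB : i ∈ B <;> by_cases hiC : i ∈ C <;> simp [hiB, hiC, hx0 i, hy0 i] at h ⊢

lemma OptimalBasis.nonneg {M : Matrix ι ι ℝ} {q : ι → ℝ} {B : Finset ι}
    (h : OptimalBasis M q B) (i : ι) : 0 ≤ ((basisMatrix M B)⁻¹ *ᵥ q) i := by
  obtain ⟨-, hw, hz, -⟩ := h
  by_cases hi : i ∈ B
  · simpa [zvec, hi] using hz i
  · simpa [wvec, hi] using hw i

lemma basisMatrix_submatrix_mulVec (M : Matrix κ κ ℝ) {f : ι → κ} (hf : Function.Injective f)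
    {B : Finset κ} {C : Finset ι} (hBC : ∀ i, i ∈ C ↔ f i ∈ B)
    (h0 : ∀ i, ∀ j ∉ Set.range f, basisMatrix M B (f i) j = 0) (x : κ → ℝ) :
    basisMatrix (M.submatrix f f) C *ᵥ (x ∘ f) = (basisMatrix M B *ᵥ x) ∘ f := by
  ext i
  refine Fintype.sum_of_injective f hf _ _ (fun j hj => ?_) (fun j => ?_)
  · simp [h0 i j hj]
  · simp [basisMatrix, hBC, hf.eq_iff]

lemma Nondeg.submatrix {M : Matrix κ κ ℝ} {q : κ → ℝ} (hnd : Nondeg M q)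
    (hM : ReversesNoSign M) {f : ι → κ} (hf : Function.Injective f) :
    Nondeg (M.submatrix f f) (q ∘ f) := by
  intro C i
  have h := basisMatrix_submatrix_mulVec M hf (B := C.image f) (C := C)
    (fun i => by simp [hf.eq_iff]) (fun i j hj => by
      have h1 : j ∉ C.image f := fun h => hj (by
        obtain ⟨c, -, rfl⟩ := Finset.mem_image.1 h
        exact ⟨c, rfl⟩)
      have h2 : f i ≠ j := fun h => hj ⟨i, h⟩
      simp [basisMatrix, h1, h2]) ((basisMatrix M (C.image f))⁻¹ *ᵥ q)
  rw [hM.basisMatrix_mulVec_inv] at h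
  rw [(hM.submatrix hf).basisMatrix_inv_mulVec_eq h]
  exact hnd _ _

end PMatrix

lemma mem_candidate {n : ℕ} {Bf : ∀ j : ℕ, j ≤ n → Finset (Fin j)} {k : ℕ} {hkn : k ≤ n}
    {l : ℕ} {hl : l ≤ k} {i : Fin k} :
    i ∈ candidate Bf k hkn l hl ↔
      (∃ h : (i : ℕ) < l - 1, (⟨i, h⟩ : Fin (l - 1)) ∈ Bf (l - 1) (by omega)) ∨ l ≤ (i : ℕ) := by
  simp only [candidate, Finset.mem_union, Finset.mem_image, Finset.mem_filter, Finset.mem_univ,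
    true_and]
  refine or_congr ⟨?_, ?_⟩ Iff.rfl
  · rintro ⟨j, hj, rfl⟩
    exact ⟨j.2, hj⟩
  · rintro ⟨h, hj⟩
    exact ⟨_, hj, rfl⟩

lemma candidate_ne_of_lt {n : ℕ} (Bf : ∀ j : ℕ, j ≤ n → Finset (Fin j)) {k : ℕ} (hkn : k ≤ n)
    {l₁ l₂ : ℕ} (hl₁ : l₁ ≤ k) (hl₂ : l₂ ≤ k) (h : l₁ < l₂) :
    candidate Bf k hkn l₁ hl₁ ≠ candidate Bf k hkn l₂ hl₂ := by
  intro he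
  have h1 : (⟨l₂ - 1, by omega⟩ : Fin k) ∈ candidate Bf k hkn l₁ hl₁ :=
    mem_candidate.2 (Or.inr (by simp only; omega))
  rw [he] at h1
  rcases mem_candidate.1 h1 with ⟨h2, -⟩ | h2 <;> simp only at h2 <;> omega

/-- Below an index missing from the basis, a basic solution of a lower Hessenberg system restricts
to a basic solution of the leading subsystem. -/
lemma LowerHessenberg.basisMatrix_restrict {k m : ℕ} {M : Matrix (Fin k) (Fin k) ℝ}
    (hH : LowerHessenberg M) (hm : m < k) {B : Finset (Fin k)} (hB : (⟨m, hm⟩ : Fin k) ∉ B)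
    {C : Finset (Fin m)} (hC : ∀ i, i ∈ C ↔ Fin.castLE hm.le i ∈ B) (x : Fin k → ℝ) :
    basisMatrix (M.submatrix (Fin.castLE hm.le) (Fin.castLE hm.le)) C *ᵥ (x ∘ Fin.castLE hm.le) =
      (basisMatrix M B *ᵥ x) ∘ Fin.castLE hm.le := by
  refine basisMatrix_submatrix_mulVec M (Fin.castLE_injective _) hC (fun i j hj => ?_) x
  have hmj : m ≤ j := by
    by_contra! h
    exact hj ⟨⟨j, h⟩, rfl⟩
  have hij : Fin.castLE hm.le i ≠ j := fun h => hj ⟨i, h⟩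
  by_cases hjB : j ∈ B
  · have hne : (j : ℕ) ≠ m := by
      rintro h
      exact hB (by convert hjB; exact h.symm)
    have := i.2
    have h0 := hH (Fin.castLE hm.le i) j (by simp only [Fin.val_castLE]; omega)
    simp [basisMatrix, hjB, h0]
  · simp [basisMatrix, hjB, hij]

/-- `B(k)` is the unique member of the `(k+1)`-element candidate
family `{B(ℓ) ∪ {ℓ+2,…,k} : ℓ ∈ {-1,…,k-1}}` whose basis matrix solves the
subproblem nonnegatively; the candidates are pairwise distinct (so the family
has exactly `k+1` elements), and hence the optimal basis `B(n)` can be found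
with at most `∑_{k=1}^n k = C(n+1, 2)` basis tests. -/
theorem stmt_10 (n : ℕ) (M : Matrix (Fin n) (Fin n) ℝ) (q : Fin n → ℝ)
    (hM : IsPMatrix M) (hH : LowerHessenberg M) (hnd : Nondeg M q)
    (Bf : ∀ k : ℕ, k ≤ n → Finset (Fin k))
    (hBf : ∀ (k : ℕ) (hk : k ≤ n),
      OptimalBasis (M.submatrix (Fin.castLE hk) (Fin.castLE hk))
        (fun j => q (Fin.castLE hk j)) (Bf k hk)) :
    (∀ (k : ℕ) (hk1 : 1 ≤ k) (hkn : k ≤ n),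
      (∃ l : ℕ, ∃ hl : l ≤ k, Bf k hkn = candidate Bf k hkn l hl) ∧
      (∀ i, 0 ≤ ((basisMatrix (M.submatrix (Fin.castLE hkn) (Fin.castLE hkn))
          (Bf k hkn))⁻¹ *ᵥ (fun j => q (Fin.castLE hkn j))) i) ∧
      (∀ (l : ℕ) (hl : l ≤ k),
        (∀ i, 0 ≤ ((basisMatrix (M.submatrix (Fin.castLE hkn) (Fin.castLE hkn))
            (candidate Bf k hkn l hl))⁻¹ *ᵥ (fun j => q (Fin.castLE hkn j))) i) →
        candidate Bf k hkn l hl = Bf k hkn) ∧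
      (∀ (l₁ l₂ : ℕ) (hl₁ : l₁ ≤ k) (hl₂ : l₂ ≤ k),
        candidate Bf k hkn l₁ hl₁ = candidate Bf k hkn l₂ hl₂ → l₁ = l₂)) ∧
    ∑ k ∈ Finset.Icc 1 n, k = (n + 1).choose 2 := by
  have hR := hM.reversesNoSign
  have hsub (k : ℕ) (hk : k ≤ n) :
      ReversesNoSign (M.submatrix (Fin.castLE hk) (Fin.castLE hk)) :=
    hR.submatrix (Fin.castLE_injective hk)
  have huniq (k : ℕ) (hk : k ≤ n) (C : Finset (Fin k))
      (hC : ∀ i, 0 ≤ ((basisMatrix (M.submatrix (Fin.castLE hk) (Fin.castLE hk)) C)⁻¹ *ᵥ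
        (fun j => q (Fin.castLE hk j))) i) : C = Bf k hk :=
    (hsub k hk).basis_unique (hnd.submatrix hR (Fin.castLE_injective hk)) hC (hBf k hk).nonneg
  refine ⟨fun k _ hkn => ⟨?_, (hBf k hkn).nonneg, fun l hl h => huniq k hkn _ h,
    fun l₁ l₂ hl₁ hl₂ h => ?_⟩, ?_⟩
  · by_cases hall : ∃ m, ∃ hm : m < k, (⟨m, hm⟩ : Fin k) ∉ Bf k hkn ∧
        ∀ i : Fin k, m < i → i ∈ Bf k hkn
    · obtain ⟨m, hm, hmB, hmax⟩ := hall
      refine ⟨m + 1, hm, ?_⟩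
      have hC : (Finset.univ.filter fun i : Fin m => Fin.castLE hm.le i ∈ Bf k hkn) =
          Bf m (hm.le.trans hkn) := by
        refine huniq m (hm.le.trans hkn) _ fun i => ?_
        have hHk : LowerHessenberg (M.submatrix (Fin.castLE hkn) (Fin.castLE hkn)) :=
          fun i j hij => hH _ _ hij
        have h := hHk.basisMatrix_restrict hm hmB
          (C := Finset.univ.filter fun i : Fin m => Fin.castLE hm.le i ∈ Bf k hkn) (by simp)
          ((basisMatrix (M.submatrix (Fin.castLE hkn) (Fin.castLE hkn)) (Bf k hkn))⁻¹ *ᵥ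
            (fun j => q (Fin.castLE hkn j)))
        rw [(hsub k hkn).basisMatrix_mulVec_inv] at h
        have h' := (hsub m (hm.le.trans hkn)).basisMatrix_inv_mulVec_eq h
        have h'' := congrFun h' i
        exact ((hBf k hkn).nonneg (Fin.castLE hm.le i)).trans_eq h''.symm
      ext i
      rw [mem_candidate]
      rcases lt_trichotomy (i : ℕ) m with h | h | h
      · have hi : i ∈ Bf k hkn ↔ (⟨i, h⟩ : Fin m) ∈ Bf m (hm.le.trans hkn) := by
          rw [← hC, Finset.mem_filter]
          exact ⟨fun hi => ⟨Finset.mem_univ _, hi⟩, fun hi => hi.2⟩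
        rw [hi]
        refine ⟨fun hm' => Or.inl ⟨h, hm'⟩, fun hm' => ?_⟩
        rcases hm' with ⟨_, hm'⟩ | hm'
        · exact hm'
        · omega
      · have : i = ⟨m, hm⟩ := Fin.ext h
        simp [this, hmB]
      · simp [hmax i h, Nat.succ_le_of_lt h]
    · refine ⟨0, Nat.zero_le _, ?_⟩
      have huniv : Bf k hkn = Finset.univ := by
        by_contra hne
        obtain ⟨i, hi⟩ : (Bf k hkn)ᶜ.Nonempty := by
          rwa [Finset.nonempty_iff_ne_empty, Ne, Finset.compl_eq_empty_iff]
        have hmem := Finset.max'_mem (Bf k hkn)ᶜ ⟨i, hi⟩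
        refine hall ⟨(Bf k hkn)ᶜ.max' ⟨i, hi⟩, Fin.isLt _, by simpa using hmem, fun j hj => ?_⟩
        by_contra hjB
        exact absurd (Finset.le_max' _ j (by simpa using hjB)) (not_le.2 hj)
      rw [huniv]
      ext i
      simp [mem_candidate]
  · by_contra hne
    rcases lt_or_gt_of_ne hne with hlt | hlt
    · exact candidate_ne_of_lt Bf hkn hl₁ hl₂ hlt h
    · exact candidate_ne_of_lt Bf hkn hl₂ hl₁ hlt h.symm
  · have h := Finset.sum_range_id (n + 1)
    rw [Finset.sum_range_succ', add_zero] at h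
    rw [Nat.choose_two_right, ← h, Finset.range_eq_Ico, Finset.sum_Ico_add' (fun k => k) 0 n 1]
    rfl
end
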